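/- Let ρ ≥ 1 be an integer, ρ* its radical (the product of its distinct prime factors), and q = ρ²ρ*. There is an absolute constant C such that for all integers b₁, b₂, b₃, b₄ coprime to q, one has |G_q(b₁,b₂,b₃,b₄)| ≤ C q^{5/2} (ρ*)^{1/2} N₂(ρ), where N₂(ρ) is the number of tuples (u, u₁, u₂, u₃, u₄) of residues modulo ρ, each coprime to ρ, such that for one (equivalently, every) lift of the tuple to integers coprime to ρρ* one has ∑_{i=1}^{4} (u uᵢ + b̄ᵢ ūᵢ) ≡ 0 (mod ρρ*) and u uᵢ ≡ b̄ᵢ ūᵢ (mod ρ) for i = 1, 2, 3, 4, with x̄ denoting the multiplicative inverse of x modulo ρρ* and b̄ᵢ the inverse of bᵢ modulo ρρ*. -/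

import Mathlib

/-- `e_q(x) = exp(2πi x / q)`. -/
noncomputable def eInt (q : ℕ) (x : ℤ) : ℂ := Complex.exp (2 * Real.pi * Complex.I * x / q)

/-- A natural-number representative of the multiplicative inverse of `x` modulo `q`. -/
noncomputable def invMod (q : ℕ) (x : ℤ) : ℕ := (((x : ZMod q))⁻¹).val

/-- The Kloosterman sum `S(a,b;q) = ∑_{x mod q, (x,q)=1} e_q(a x + b x̄)`. -/
noncomputable def Kloos (q : ℕ) (a b : ℤ) : ℂ :=
  ∑ x ∈ (Finset.range q).filter (fun x => Nat.Coprime x q), eInt q (a * x + b * invMod q x)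

/-- `G_q(b₁,b₂,b₃,b₄) = ∑_{h mod q} S(h,b̄₁;q) S(h,b̄₂;q) S(h,b̄₃;q) S(h,b̄₄;q)`. -/
noncomputable def Gquad (q : ℕ) (b₁ b₂ b₃ b₄ : ℤ) : ℂ :=
  ∑ h ∈ Finset.range q,
    Kloos q h (invMod q b₁) * Kloos q h (invMod q b₂) *
      Kloos q h (invMod q b₃) * Kloos q h (invMod q b₄)

/-- The radical of `n`: the product of its distinct prime factors. -/
def rad (n : ℕ) : ℕ := ∏ p ∈ n.primeFactors, p

/-- The defining conditions of `N₂(ρ)` on an integer lift `(u, v₁, …, v₄)`: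
`∑ᵢ (u vᵢ + b̄ᵢ v̄ᵢ) ≡ 0 (mod ρρ*)` and `u vᵢ ≡ b̄ᵢ v̄ᵢ (mod ρ)`, where inverses are taken
modulo `ρρ*`. -/
def N2cond (ρ : ℕ) (b : Fin 4 → ℤ) (u : ℤ) (v : Fin 4 → ℤ) : Prop :=
  (∑ i, ((u : ZMod (ρ * rad ρ)) * (v i : ZMod (ρ * rad ρ)) +
      ((b i : ZMod (ρ * rad ρ)))⁻¹ * ((v i : ZMod (ρ * rad ρ)))⁻¹) = 0) ∧
  ∀ i, ZMod.castHom (dvd_mul_right ρ (rad ρ)) (ZMod ρ)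
        ((u : ZMod (ρ * rad ρ)) * (v i : ZMod (ρ * rad ρ))) =
      ZMod.castHom (dvd_mul_right ρ (rad ρ)) (ZMod ρ)
        (((b i : ZMod (ρ * rad ρ)))⁻¹ * ((v i : ZMod (ρ * rad ρ)))⁻¹)

/-- `N₂(ρ)`: the number of tuples `(u,u₁,…,u₄)` of residues modulo `ρ`, coprime to `ρ`,
admitting a lift to integers coprime to `ρρ*` satisfying the conditions `N2cond`. -/
noncomputable def N2 (ρ : ℕ) (b : Fin 4 → ℤ) : ℕ :=
  Nat.card {t : ZMod ρ × (Fin 4 → ZMod ρ) //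
    IsUnit t.1 ∧ (∀ i, IsUnit (t.2 i)) ∧
      ∃ (u : ℤ) (v : Fin 4 → ℤ), Int.gcd u (ρ * rad ρ) = 1 ∧
        (∀ i, Int.gcd (v i) (ρ * rad ρ) = 1) ∧
        (u : ZMod ρ) = t.1 ∧ (∀ i, (v i : ZMod ρ) = t.2 i) ∧ N2cond ρ b u v}

section FiniteRing

open Finset

variable {R : Type*} [CommRing R]

theorem map_sum_eq_prod {ι : Type*} (ψ : AddChar R ℂ) (t : Finset ι) (f : ι → R) :
    ψ (∑ i ∈ t, f i) = ∏ i ∈ t, ψ (f i) := by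
  classical
  induction t using Finset.induction_on with
  | empty => simp
  | insert i t hi ih => rw [sum_insert hi, prod_insert hi, AddChar.map_add_eq_mul, ih]

/-- The unit `1 + r z` for an element `r` with vanishing cube. -/
def oneAddMulUnit (r : R) (hr : r ^ 3 = 0) (z : R) : Rˣ where
  val := 1 + r * z
  inv := 1 - r * z + r ^ 2 * z ^ 2
  val_inv := by linear_combination z ^ 3 * hr
  inv_val := by linear_combination z ^ 3 * hr

/-- The Kloosterman phase `ψ(u x + c x⁻¹)`. -/
def kloosPhase (ψ : AddChar R ℂ) (c : Rˣ) (u : R) (x : Rˣ) : ℂ :=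
  ψ (u * x + c * (x⁻¹ : Rˣ))

theorem kloosPhase_mul_oneAddMulUnit (ψ : AddChar R ℂ) {r : R} (hr : r ^ 3 = 0)
    (c : Rˣ) (u : R) (x : Rˣ) (t : R) :
    kloosPhase ψ c u (x * oneAddMulUnit r hr t) =
      kloosPhase ψ c u x *
        ψ (c * (x⁻¹ : Rˣ) * r ^ 2 * t ^ 2 + r * (u * x - c * (x⁻¹ : Rˣ)) * t) := by
  rw [kloosPhase, kloosPhase, ← AddChar.map_add_eq_mul, mul_inv]
  congr 1
  simp only [Units.val_mul, oneAddMulUnit, Units.inv_mk]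
  ring

variable [Fintype R] [DecidableEq R]

/-- The square of a quadratic Gauss sum over a finite ring is controlled by the kernel of
multiplication by twice the leading coefficient. -/
theorem norm_sq_sum_addChar_quadratic_le (ψ : AddChar R ℂ) (hψ : ψ.IsPrimitive) (a b : R) :
    ‖∑ t, ψ (a * t ^ 2 + b * t)‖ ^ 2 ≤
      (Fintype.card R : ℝ) * (#{d : R | 2 * a * d = 0} : ℕ) := by
  have key : (∑ t, ψ (a * t ^ 2 + b * t)) * (starRingEnd ℂ) (∑ t, ψ (a * t ^ 2 + b * t)) =
      ∑ d, ψ (a * d ^ 2 + b * d) * ((if 2 * a * d = 0 then Fintype.card R else 0 : ℕ) : ℂ) := by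
    rw [map_sum, Finset.sum_mul_sum, Finset.sum_comm]
    calc ∑ s, ∑ t, ψ (a * t ^ 2 + b * t) * (starRingEnd ℂ) (ψ (a * s ^ 2 + b * s))
        = ∑ s, ∑ d, ψ (a * d ^ 2 + b * d) * ψ (s * (2 * a * d)) := by
          refine sum_congr rfl fun s _ => ?_
          rw [← Equiv.sum_comp (Equiv.addRight s)]
          refine sum_congr rfl fun d _ => ?_
          rw [← AddChar.map_neg_eq_conj, ← AddChar.map_add_eq_mul, ← AddChar.map_add_eq_mul]
          congr 1
          simp only [Equiv.coe_addRight]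
          ring
      _ = _ := by
          rw [sum_comm]
          refine sum_congr rfl fun d _ => ?_
          rw [← mul_sum, AddChar.sum_mulShift _ hψ]
  have h2 : ((‖∑ t, ψ (a * t ^ 2 + b * t)‖ ^ 2 : ℝ) : ℂ) =
      (∑ t, ψ (a * t ^ 2 + b * t)) * (starRingEnd ℂ) (∑ t, ψ (a * t ^ 2 + b * t)) := by
    rw [RCLike.mul_conj]; push_cast; rfl
  have h3 : ‖∑ t, ψ (a * t ^ 2 + b * t)‖ ^ 2 = ‖∑ d, ψ (a * d ^ 2 + b * d) *
      ((if 2 * a * d = 0 then Fintype.card R else 0 : ℕ) : ℂ)‖ := by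
    rw [← key, ← h2, Complex.norm_real, Real.norm_of_nonneg (by positivity)]
  rw [h3]
  refine (norm_sum_le _ _).trans ?_
  simp only [norm_mul, AddChar.norm_apply, one_mul, Complex.norm_natCast]
  rw [← Nat.cast_sum, ← sum_filter, sum_const, smul_eq_mul, Nat.cast_mul, mul_comm]

/-- The summands of a Kloosterman sum after averaging over the cosets of `1 + r R`, restricted to
the approximate stationary points. -/
def kloosLocal (ψ : AddChar R ℂ) (r s : R) (hr : r ^ 3 = 0) (c : Rˣ) (u : R) (x : Rˣ) : ℂ :=
  if r * s * (u * x - c * (x⁻¹ : Rˣ)) = 0 then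
    ∑ t, kloosPhase ψ c u (x * oneAddMulUnit r hr t) else 0

variable (ψ : AddChar R ℂ) {r s : R} (hr : r ^ 3 = 0)

theorem sum_kloosPhase_eq_sum_stationary (hψ : ψ.IsPrimitive) (hrs : r ^ 2 * s = 0)
    (hr : r ^ 3 = 0) (c : Rˣ) (u : R) :
    ∑ x, kloosPhase ψ c u x =
      ∑ x : Rˣ, if r * s * (u * x - c * (x⁻¹ : Rˣ)) = 0 then kloosPhase ψ c u x else 0 := by
  have hq : (Fintype.card R : ℂ) ≠ 0 := by exact_mod_cast Fintype.card_ne_zero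
  apply mul_left_cancel₀ hq
  calc (Fintype.card R : ℂ) * ∑ x, kloosPhase ψ c u x
      = ∑ t : R, ∑ x, kloosPhase ψ c u (x * oneAddMulUnit r hr (s * t)) := by
        rw [← nsmul_eq_mul, ← card_univ, ← sum_const]
        exact sum_congr rfl fun t _ =>
          (Equiv.sum_comp (Equiv.mulRight (oneAddMulUnit r hr (s * t))) _).symm
    _ = ∑ x : Rˣ, kloosPhase ψ c u x * ∑ t : R, ψ (t * (r * s * (u * x - c * (x⁻¹ : Rˣ)))) := by
        rw [sum_comm]
        refine sum_congr rfl fun x _ => ?_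
        rw [mul_sum]
        refine sum_congr rfl fun t _ => ?_
        rw [kloosPhase_mul_oneAddMulUnit]
        congr 2
        linear_combination c * (x⁻¹ : Rˣ) * s * t ^ 2 * hrs
    _ = _ := by
        rw [mul_sum]
        refine sum_congr rfl fun x _ => ?_
        rw [AddChar.sum_mulShift _ hψ]
        split_ifs <;> simp [mul_comm]

theorem card_mul_sum_kloosPhase (hψ : ψ.IsPrimitive) (hrs : r ^ 2 * s = 0)
    (hr : r ^ 3 = 0) (c : Rˣ) (u : R) :
    (Fintype.card R : ℂ) * ∑ x, kloosPhase ψ c u x = ∑ x, kloosLocal ψ r s hr c u x := by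
  rw [sum_kloosPhase_eq_sum_stationary ψ hψ hrs hr, ← nsmul_eq_mul, ← card_univ, ← sum_const]
  have : ∀ x, kloosLocal ψ r s hr c u x = ∑ t,
      if r * s * (u * x - c * (x⁻¹ : Rˣ)) = 0 then
        kloosPhase ψ c u (x * oneAddMulUnit r hr t) else 0 := by
    intro x; unfold kloosLocal; split_ifs <;> simp
  simp_rw [this]
  rw [sum_comm (t := univ (α := R))]
  refine sum_congr rfl fun t _ => ?_
  rw [← Equiv.sum_comp (Equiv.mulRight (oneAddMulUnit r hr t))]
  refine sum_congr rfl fun x _ => ?_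
  refine if_congr (Eq.congr ?_ rfl) rfl rfl
  simp only [Equiv.coe_mulRight, mul_inv, Units.val_mul, oneAddMulUnit, Units.inv_mk]
  linear_combination (u * x * t + c * (x⁻¹ : Rˣ) * t - c * (x⁻¹ : Rˣ) * r * t ^ 2) * hrs

theorem kloosLocal_scale (hsr : s ∣ r) (c : Rˣ) (u : R) (x : Rˣ) (z : R) :
    kloosLocal ψ r s hr c (u * (oneAddMulUnit r hr z : R) ^ 2) (x * (oneAddMulUnit r hr z)⁻¹) =
      ψ (z * (r * (u * x + c * (x⁻¹ : Rˣ)))) * kloosLocal ψ r s hr c u x := by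
  set w := oneAddMulUnit r hr z with hw
  have hwval : (w : R) = 1 + r * z := rfl
  have h1 : u * (w : R) ^ 2 * (x * w⁻¹ : Rˣ) = w * (u * x) := by
    rw [Units.val_mul]
    linear_combination (u * w * x) * w.mul_inv
  have h2 : (((x * w⁻¹)⁻¹ : Rˣ) : R) = w * (x⁻¹ : Rˣ) := by
    rw [mul_inv, inv_inv, Units.val_mul, mul_comm]
  unfold kloosLocal
  have hcond : (r * s * (u * (w : R) ^ 2 * (x * w⁻¹ : Rˣ) - c * ((x * w⁻¹)⁻¹ : Rˣ)) = 0) ↔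
      r * s * (u * x - c * (x⁻¹ : Rˣ)) = 0 := by
    rw [h1, h2, ← w.mul_right_eq_zero (a := r * s * (u * x - c * (x⁻¹ : Rˣ)))]
    refine Eq.congr ?_ rfl
    ring
  simp only [hcond]
  split_ifs with h
  · rw [mul_sum]
    refine sum_congr rfl fun t _ => ?_
    rw [kloosPhase, kloosPhase, ← AddChar.map_add_eq_mul]
    congr 1
    obtain ⟨m, hm⟩ := hsr
    rw [mul_inv, Units.val_mul _ (oneAddMulUnit r hr t), ← mul_assoc, h1, Units.val_mul _ (_)⁻¹, h2,
      mul_inv, Units.val_mul, Units.val_mul, hwval]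
    simp only [oneAddMulUnit, Units.inv_mk]
    have h4 : r ^ 2 * (u * x - c * (x⁻¹ : Rˣ)) = 0 := by
      linear_combination m * h + r * (u * x - c * (x⁻¹ : Rˣ)) * hm
    linear_combination t * z * h4 + c * (x⁻¹ : Rˣ) * t ^ 2 * z * hr
  · simp

theorem norm_sq_kloosLocal_le (hψ : ψ.IsPrimitive) (c : Rˣ) (u : R) (x : Rˣ) :
    ‖kloosLocal ψ r s hr c u x‖ ^ 2 ≤
      (Fintype.card R : ℝ) * (#{d : R | 2 * r ^ 2 * d = 0} : ℕ) := by
  unfold kloosLocal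
  split_ifs with h
  · simp_rw [kloosPhase_mul_oneAddMulUnit]
    rw [← mul_sum, norm_mul, kloosPhase, AddChar.norm_apply, one_mul]
    refine (norm_sq_sum_addChar_quadratic_le ψ hψ _ _).trans_eq ?_
    congr 3
    ext d
    simp only [mem_filter, mem_univ, true_and]
    rw [← (c * x⁻¹).mul_right_eq_zero (a := 2 * r ^ 2 * d)]
    refine Eq.congr ?_ rfl
    rw [Units.val_mul]
    ring
  · rw [norm_zero, zero_pow two_ne_zero]; positivity

/-- The simultaneous stationary points of a product of Kloosterman sums, summed over the first
argument. -/
def stationaryTuples {ι : Type*} [Fintype ι] [DecidableEq ι] (r s : R) (c : ι → Rˣ) :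
    Finset (R × (ι → Rˣ)) :=
  {a | (∀ i, r * s * (a.1 * a.2 i - c i * ((a.2 i)⁻¹ : Rˣ)) = 0) ∧
    r * ∑ i, (a.1 * a.2 i + c i * ((a.2 i)⁻¹ : Rˣ)) = 0}

theorem card_pow_mul_sum_prod_kloos {ι : Type*} [Fintype ι] [DecidableEq ι]
    (hψ : ψ.IsPrimitive) (hrs : r ^ 2 * s = 0) (hsr : s ∣ r) (c : ι → Rˣ) :
    (Fintype.card R : ℂ) ^ Fintype.card ι * ∑ u, ∏ i, ∑ x, kloosPhase ψ (c i) u x =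
      ∑ a ∈ stationaryTuples r s c, ∏ i, kloosLocal ψ r s hr (c i) a.1 (a.2 i) := by
  have hq : (Fintype.card R : ℂ) ≠ 0 := by exact_mod_cast Fintype.card_ne_zero
  have h1 : (Fintype.card R : ℂ) ^ Fintype.card ι * ∑ u, ∏ i, ∑ x, kloosPhase ψ (c i) u x =
      ∑ a : R × (ι → Rˣ), ∏ i, kloosLocal ψ r s hr (c i) a.1 (a.2 i) := by
    rw [mul_sum, Fintype.sum_prod_type]
    refine sum_congr rfl fun u _ => ?_
    rw [← card_univ (α := ι), ← prod_const, ← prod_mul_distrib]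
    simp_rw [card_mul_sum_kloosPhase ψ hψ hrs hr]
    rw [Fintype.prod_sum]
  rw [h1]
  apply mul_left_cancel₀ hq
  let e (z : R) : R × (ι → Rˣ) ≃ R × (ι → Rˣ) :=
    (Units.mulRight (oneAddMulUnit r hr z ^ 2)).prodCongr
      (Equiv.mulRight fun _ => (oneAddMulUnit r hr z)⁻¹)
  calc (Fintype.card R : ℂ) * ∑ a : R × (ι → Rˣ), ∏ i, kloosLocal ψ r s hr (c i) a.1 (a.2 i)
      = ∑ z : R, ∑ a : R × (ι → Rˣ),
          ∏ i, kloosLocal ψ r s hr (c i) (e z a).1 ((e z a).2 i) := by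
        rw [← nsmul_eq_mul, ← card_univ, ← sum_const]
        exact sum_congr rfl fun z _ => ((e z).sum_comp
          fun a => ∏ i, kloosLocal ψ r s hr (c i) a.1 (a.2 i)).symm
    _ = ∑ a : R × (ι → Rˣ), (∑ z, ψ (z * (r * ∑ i, (a.1 * a.2 i + c i * ((a.2 i)⁻¹ : Rˣ))))) *
          ∏ i, kloosLocal ψ r s hr (c i) a.1 (a.2 i) := by
        rw [sum_comm]
        refine sum_congr rfl fun a _ => ?_
        rw [sum_mul]
        refine sum_congr rfl fun z _ => ?_
        simp_rw [mul_sum]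
        rw [map_sum_eq_prod, ← prod_mul_distrib]
        exact prod_congr rfl fun i _ => kloosLocal_scale ψ hr hsr (c i) a.1 (a.2 i) z
    _ = _ := by
        simp_rw [AddChar.sum_mulShift _ hψ]
        rw [mul_sum, stationaryTuples, sum_filter]
        refine sum_congr rfl fun a _ => ?_
        by_cases hΦ : r * ∑ i, (a.1 * a.2 i + c i * ((a.2 i)⁻¹ : Rˣ)) = 0
        · by_cases hκ : ∀ i, r * s * (a.1 * a.2 i - c i * ((a.2 i)⁻¹ : Rˣ)) = 0
          · simp only [hΦ, hκ, implies_true, and_self, if_true]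
          · push Not at hκ
            obtain ⟨i, hi⟩ := hκ
            have h0 : ∏ i, kloosLocal ψ r s hr (c i) a.1 (a.2 i) = 0 :=
              prod_eq_zero (mem_univ i) (if_neg hi)
            simp [h0]
        · simp [hΦ]

end FiniteRing

theorem rad_dvd (n : ℕ) : rad n ∣ n := Nat.prod_primeFactors_dvd n

theorem rad_pos (n : ℕ) : 0 < rad n :=
  Finset.prod_pos fun _ hp => (Nat.prime_of_mem_primeFactors hp).pos

theorem eInt_eq_stdAddChar (q : ℕ) [NeZero q] (x : ℤ) :
    eInt q x = ZMod.stdAddChar (x : ZMod q) := (ZMod.stdAddChar_coe x).symm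

theorem Kloos_eq_sum_kloosPhase (q : ℕ) [NeZero q] (h b : ℤ) (c : (ZMod q)ˣ)
    (hc : (c : ZMod q) = (b : ZMod q)) :
    Kloos q h b = ∑ x, kloosPhase ZMod.stdAddChar c (h : ZMod q) x := by
  refine Finset.sum_bij' (fun x hx => ZMod.unitOfCoprime x (Finset.mem_filter.1 hx).2)
    (fun x _ => (x : ZMod q).val) (fun _ _ => Finset.mem_univ _) ?_ ?_ ?_ ?_
  · intro x _
    rw [Finset.mem_filter, Finset.mem_range]
    exact ⟨ZMod.val_lt _, ZMod.val_coe_unit_coprime x⟩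
  · intro x hx
    rw [Finset.mem_filter, Finset.mem_range] at hx
    rw [ZMod.coe_unitOfCoprime, ZMod.val_cast_of_lt hx.1]
  · intro x _
    ext
    simp
  · intro x hx
    rw [eInt_eq_stdAddChar, kloosPhase, hc, ← ZMod.inv_coe_unit, ZMod.coe_unitOfCoprime, invMod]
    simp

theorem Gquad_eq_sum_prod (q : ℕ) [NeZero q] (b : Fin 4 → ℤ) (c : Fin 4 → (ZMod q)ˣ)
    (hc : ∀ i, (c i : ZMod q) = (b i : ZMod q)⁻¹) :
    Gquad q (b 0) (b 1) (b 2) (b 3) =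
      ∑ u : ZMod q, ∏ i, ∑ x, kloosPhase ZMod.stdAddChar (c i) u x := by
  have hc' : ∀ i, (c i : ZMod q) = ((invMod q (b i) : ℤ) : ZMod q) := by
    intro i; rw [hc, invMod]; simp
  refine Finset.sum_bij' (fun h _ => (h : ZMod q)) (fun u _ => u.val)
    (fun _ _ => Finset.mem_univ _) (fun u _ => Finset.mem_range.2 u.val_lt) ?_ ?_ ?_
  · intro h hh
    exact ZMod.val_cast_of_lt (Finset.mem_range.1 hh)
  · intro u _
    simp
  · intro h _
    rw [Fin.prod_univ_four]
    simp_rw [fun i => Kloos_eq_sum_kloosPhase q h _ (c i) (hc' i), Int.cast_natCast]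

theorem castHom_eq_intCast {n m : ℕ} (h : m ∣ n) (a : ZMod n) :
    ZMod.castHom h (ZMod m) a = ((a.cast : ℤ) : ZMod m) := by
  conv_lhs => rw [← ZMod.intCast_zmod_cast a]
  exact map_intCast _ _

theorem castHom_eq_zero_iff {k m n : ℕ} (hk : k ≠ 0) (hn : n = k * m) (h : m ∣ n) (a : ZMod n) :
    ZMod.castHom h (ZMod m) a = 0 ↔ (k : ZMod n) * a = 0 := by
  have ha : (k : ZMod n) * a = ((k * a.cast : ℤ) : ZMod n) := by simp
  rw [castHom_eq_intCast, ha, ZMod.intCast_zmod_eq_zero_iff_dvd,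
    ZMod.intCast_zmod_eq_zero_iff_dvd, (congrArg Nat.cast hn : (n : ℤ) = _), Nat.cast_mul,
    mul_dvd_mul_iff_left (Int.natCast_ne_zero.2 hk)]

theorem card_natCast_mul_eq_zero_le {n k : ℕ} [NeZero n] (hk : 0 < k) :
    (Finset.univ.filter fun d : ZMod n => (k : ZMod n) * d = 0).card ≤ k := by
  simp_rw [← nsmul_eq_mul]
  exact IsAddCyclic.card_nsmul_eq_zero_le hk

theorem gcd_eq_one_of_isUnit {m : ℕ} {a : ℤ} (h : IsUnit (a : ZMod m)) : Int.gcd a m = 1 :=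
  Int.isCoprime_iff_gcd_eq_one.1 ((ZMod.coe_int_isUnit_iff_isCoprime a m).1 h).symm

theorem card_fiber_reduction_le {n k m : ℕ} [NeZero n] (hk : 0 < k) (hn : n = k * m) (h : m ∣ n)
    (S : Finset (ZMod n × (Fin 4 → (ZMod n)ˣ))) (t : ZMod m × (Fin 4 → ZMod m)) :
    (S.filter fun a => (ZMod.castHom h (ZMod m) a.1,
      fun i => ZMod.castHom h (ZMod m) (a.2 i : ZMod n)) = t).card ≤ k ^ 5 := by
  classical
  set F := S.filter fun a => (ZMod.castHom h (ZMod m) a.1,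
      fun i => ZMod.castHom h (ZMod m) (a.2 i : ZMod n)) = t with hF
  obtain hE | ⟨a₀, ha₀⟩ := F.eq_empty_or_nonempty
  · simp [hE]
  set K := Finset.univ.filter fun d : ZMod n => (k : ZMod n) * d = 0 with hKdef
  have hK : K.card ≤ k := card_natCast_mul_eq_zero_le hk
  have hmem : ∀ x y : ZMod n, ZMod.castHom h (ZMod m) x = ZMod.castHom h (ZMod m) y →
      x - y ∈ K := by
    intro x y hxy
    rw [hKdef, Finset.mem_filter, ← castHom_eq_zero_iff hk.ne' hn h, map_sub, hxy, sub_self]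
    exact ⟨Finset.mem_univ _, rfl⟩
  have hle : F.card ≤ (K ×ˢ Fintype.piFinset fun _ : Fin 4 => K).card := by
    refine Finset.card_le_card_of_injOn
      (fun a => (a.1 - a₀.1, fun i => (a.2 i : ZMod n) - a₀.2 i)) ?_ ?_
    · intro a ha
      have hat := (Finset.mem_filter.1 ha).2.trans (Finset.mem_filter.1 ha₀).2.symm
      rw [Prod.mk.injEq] at hat
      simp only [Finset.coe_product, Set.mem_prod, Finset.mem_coe, Fintype.mem_piFinset]
      exact ⟨hmem _ _ hat.1, fun i => hmem _ _ (congrFun hat.2 i)⟩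
    · intro a _ a' _ haa
      rw [Prod.mk.injEq] at haa
      refine Prod.ext (sub_left_injective haa.1) (funext fun i => Units.ext ?_)
      exact sub_left_injective (congrFun haa.2 i)
  refine hle.trans ?_
  rw [Finset.card_product, Fintype.card_piFinset_const]
  calc K.card * K.card ^ 4 = K.card ^ 5 := by ring
    _ ≤ k ^ 5 := Nat.pow_le_pow_left hK 5

theorem card_stationaryTuples_le {ρ : ℕ} (hρ : 1 ≤ ρ) [NeZero (ρ ^ 2 * rad ρ)] (b : Fin 4 → ℤ)
    (c : Fin 4 → (ZMod (ρ ^ 2 * rad ρ))ˣ)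
    (hc : ∀ i, (b i : ZMod (ρ ^ 2 * rad ρ)) * (c i : ZMod (ρ ^ 2 * rad ρ)) = 1) :
    (stationaryTuples (ρ : ZMod (ρ ^ 2 * rad ρ)) (rad ρ) c).card ≤
      (ρ * rad ρ) ^ 5 * N2 ρ b := by
  classical
  have : NeZero ρ := ⟨by omega⟩
  have hs := rad_pos ρ
  have h₁ : ρ ∣ ρ ^ 2 * rad ρ := ⟨ρ * rad ρ, by ring⟩
  have h₂ : ρ * rad ρ ∣ ρ ^ 2 * rad ρ := ⟨ρ, by ring⟩
  rw [N2, Nat.card_eq_fintype_card, Fintype.card_subtype]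
  refine Finset.card_le_mul_card_image_of_maps_to
    (f := fun a => (ZMod.castHom h₁ (ZMod ρ) a.1,
      fun i => ZMod.castHom h₁ (ZMod ρ) (a.2 i : ZMod (ρ ^ 2 * rad ρ)))) ?_ _
    (fun t _ => card_fiber_reduction_le (Nat.mul_pos hρ hs) (by ring) h₁ _ t)
  rintro ⟨u, x⟩ ha
  simp only [stationaryTuples, Finset.mem_filter, Finset.mem_univ, true_and] at ha ⊢
  obtain ⟨hκ, hΦ⟩ := ha
  have hκ' : ∀ i, ZMod.castHom h₁ (ZMod ρ) (u * x i) =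
      ZMod.castHom h₁ (ZMod ρ) (c i * ((x i)⁻¹ : (ZMod (ρ ^ 2 * rad ρ))ˣ)) := by
    intro i
    rw [← sub_eq_zero, ← map_sub, castHom_eq_zero_iff (Nat.mul_pos hρ hs).ne' (by ring) h₁,
      Nat.cast_mul]
    exact hκ i
  have hΦ' := (castHom_eq_zero_iff (by omega : ρ ≠ 0) (by ring) h₂ _).2 hΦ
  have hu : IsUnit (ZMod.castHom h₁ (ZMod ρ) u) := by
    refine isUnit_of_mul_isUnit_left (y := ZMod.castHom h₁ (ZMod ρ) (x 0)) ?_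
    rw [← map_mul, hκ' 0, ← Units.val_mul]
    exact (Units.isUnit _).map _
  refine ⟨hu, fun i => (x i).isUnit.map _, (u.cast : ℤ),
    fun i => ((x i : ZMod (ρ ^ 2 * rad ρ)).cast : ℤ), ?_, fun i => ?_,
    (castHom_eq_intCast h₁ u).symm, fun i => (castHom_eq_intCast h₁ _).symm, ?_⟩
  · rw [castHom_eq_intCast, ZMod.coe_int_isUnit_iff_isCoprime] at hu
    have hu' := hu.of_isCoprime_of_dvd_left (Int.natCast_dvd_natCast.2 (rad_dvd ρ))
    exact Int.isCoprime_iff_gcd_eq_one.1 (hu.mul_left hu').symm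
  · have := (x i).isUnit.map (ZMod.castHom h₂ (ZMod (ρ * rad ρ)))
    rw [castHom_eq_intCast] at this
    exact_mod_cast gcd_eq_one_of_isUnit this
  · have hb : ∀ i, ((b i : ZMod (ρ * rad ρ)))⁻¹ =
        ZMod.castHom h₂ (ZMod (ρ * rad ρ)) (c i : ZMod (ρ ^ 2 * rad ρ)) := by
      intro i
      refine ZMod.inv_eq_of_mul_eq_one _ _ _ ?_
      rw [← map_intCast (ZMod.castHom h₂ (ZMod (ρ * rad ρ))), ← map_mul, hc, map_one]
    have hx : ∀ i, (ZMod.castHom h₂ (ZMod (ρ * rad ρ)) (x i : ZMod (ρ ^ 2 * rad ρ)))⁻¹ =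
        ZMod.castHom h₂ (ZMod (ρ * rad ρ))
          ((x i)⁻¹ : (ZMod (ρ ^ 2 * rad ρ))ˣ) := by
      intro i
      refine ZMod.inv_eq_of_mul_eq_one _ _ _ ?_
      rw [← map_mul, Units.mul_inv, map_one]
    have hcomp : ∀ y, ZMod.castHom (dvd_mul_right ρ (rad ρ)) (ZMod ρ)
        (ZMod.castHom h₂ (ZMod (ρ * rad ρ)) y) = ZMod.castHom h₁ (ZMod ρ) y := fun y =>
      RingHom.congr_fun (RingHom.ext_zmod
        ((ZMod.castHom (dvd_mul_right ρ (rad ρ)) (ZMod ρ)).comp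
          (ZMod.castHom h₂ (ZMod (ρ * rad ρ)))) (ZMod.castHom h₁ (ZMod ρ))) y
    simp only [N2cond, hb, ← castHom_eq_intCast h₂, hx, ← map_mul, hcomp]
    refine ⟨?_, hκ'⟩
    simp only [← map_add, ← map_sum]
    exact hΦ'

/-- There is an absolute constant `C` such that for `ρ ≥ 1`, `q = ρ²ρ*` and `b₁,…,b₄` coprime
to `q`, one has `|G_q(b₁,b₂,b₃,b₄)| ≤ C q^{5/2} (ρ*)^{1/2} N₂(ρ)`. -/
theorem Gquad_oddpower_bound :
    ∃ C : ℝ, ∀ ρ : ℕ, 1 ≤ ρ → ∀ b : Fin 4 → ℤ,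
      (∀ i, Int.gcd (b i) (ρ ^ 2 * rad ρ) = 1) →
      ‖Gquad (ρ ^ 2 * rad ρ) (b 0) (b 1) (b 2) (b 3)‖ ≤
        C * ((ρ ^ 2 * rad ρ : ℕ) : ℝ) ^ ((5 : ℝ) / 2) * (rad ρ : ℝ) ^ ((1 : ℝ) / 2) *
          (N2 ρ b : ℝ) := by
  refine ⟨4, fun ρ hρ b hb => ?_⟩
  have hs := rad_pos ρ
  have hN : 0 < ρ ^ 2 * rad ρ := by positivity
  have : NeZero (ρ ^ 2 * rad ρ) := ⟨hN.ne'⟩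
  set N := ρ ^ 2 * rad ρ with hNdef
  have hbu : ∀ i, IsUnit (b i : ZMod N) := fun i =>
    (ZMod.coe_int_isUnit_iff_isCoprime _ _).2 (Int.isCoprime_iff_gcd_eq_one.2 (hb i)).symm
  choose B hB using hbu
  let c : Fin 4 → (ZMod N)ˣ := fun i => (B i)⁻¹
  have hc : ∀ i, (c i : ZMod N) = (b i : ZMod N)⁻¹ := fun i => by
    rw [← hB, ZMod.inv_coe_unit]
  have hbc : ∀ i, (b i : ZMod N) * c i = 1 := fun i => by rw [← hB]; exact (B i).mul_inv
  have hrs : (ρ : ZMod N) ^ 2 * (rad ρ : ZMod N) = 0 := by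
    rw [← Nat.cast_pow, ← Nat.cast_mul, ← hNdef, ZMod.natCast_self]
  have hsr : (rad ρ : ZMod N) ∣ ρ := Nat.cast_dvd_cast (rad_dvd ρ)
  have hr : (ρ : ZMod N) ^ 3 = 0 := by
    obtain ⟨m, hm⟩ := hsr
    linear_combination m * hrs + (ρ : ZMod N) ^ 2 * hm
  have hid := card_pow_mul_sum_prod_kloos ZMod.stdAddChar hr (ZMod.isPrimitive_stdAddChar N)
    hrs hsr c
  rw [← Gquad_eq_sum_prod N b c hc, ZMod.card, Fintype.card_fin] at hid
  have hlocal : ∀ a : ZMod N × (Fin 4 → (ZMod N)ˣ),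
      ‖∏ i, kloosLocal ZMod.stdAddChar (ρ : ZMod N) (rad ρ) hr (c i) a.1 (a.2 i)‖ ≤
        ((N : ℝ) * (2 * ρ ^ 2)) ^ 2 := by
    intro a
    refine abs_le_of_sq_le_sq' ?_ (by positivity) |>.2
    rw [norm_prod, ← Finset.prod_pow]
    refine (Finset.prod_le_prod (g := fun _ => (N : ℝ) * (2 * ρ ^ 2)) (fun _ _ => sq_nonneg _)
      fun i _ => ?_).trans_eq ?_
    · refine (norm_sq_kloosLocal_le ZMod.stdAddChar hr
        (ZMod.isPrimitive_stdAddChar N) _ _ _).trans ?_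
      rw [ZMod.card]
      gcongr
      have := card_natCast_mul_eq_zero_le (n := N) (k := 2 * ρ ^ 2) (by positivity)
      push_cast at this
      exact_mod_cast this
    · rw [Finset.prod_const, Finset.card_univ, Fintype.card_fin]; ring
  have hcard : ((stationaryTuples (ρ : ZMod N) (rad ρ) c).card : ℝ) ≤
      (ρ * rad ρ : ℝ) ^ 5 * N2 ρ b := by
    exact_mod_cast card_stationaryTuples_le hρ b c hbc
  have hbound : (N : ℝ) ^ 4 * ‖Gquad N (b 0) (b 1) (b 2) (b 3)‖ ≤
      (ρ * rad ρ : ℝ) ^ 5 * N2 ρ b * ((N : ℝ) * (2 * ρ ^ 2)) ^ 2 := by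
    calc (N : ℝ) ^ 4 * ‖Gquad N (b 0) (b 1) (b 2) (b 3)‖
        = ‖(N : ℂ) ^ 4 * Gquad N (b 0) (b 1) (b 2) (b 3)‖ := by simp
      _ ≤ (stationaryTuples (ρ : ZMod N) (rad ρ) c).card •
            ((N : ℝ) * (2 * ρ ^ 2)) ^ 2 := by
          rw [hid]
          exact (norm_sum_le _ _).trans (Finset.sum_le_card_nsmul _ _ _ fun a _ => hlocal a)
      _ ≤ _ := by
          rw [nsmul_eq_mul]
          gcongr
  have hρ0 : (0 : ℝ) < ρ := by exact_mod_cast hρ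
  have hs0 : (0 : ℝ) < rad ρ := by exact_mod_cast hs
  have hNR : (N : ℝ) = ρ ^ 2 * rad ρ := by rw [hNdef]; push_cast; rfl
  have hpow : (N : ℝ) ^ ((5 : ℝ) / 2) * (rad ρ : ℝ) ^ ((1 : ℝ) / 2) =
      (ρ : ℝ) ^ 5 * (rad ρ : ℝ) ^ 3 := by
    rw [hNR, Real.mul_rpow (by positivity) hs0.le, mul_assoc, ← Real.rpow_add hs0,
      ← Real.rpow_natCast (ρ : ℝ) 2, ← Real.rpow_mul hρ0.le, ← Real.rpow_natCast (ρ : ℝ) 5,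
      ← Real.rpow_natCast (rad ρ : ℝ) 3]
    norm_num
  rw [mul_assoc 4, hpow]
  have hN4 : (0 : ℝ) < (N : ℝ) ^ 4 := by positivity
  refine le_of_mul_le_mul_left (hbound.trans_eq ?_) hN4
  rw [hNR]
  ring
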